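/- Let P : ℝ^n → ℝ be convex and differentiable with ∇P Lipschitz continuous with constant h > 0. Decompose ℝ^n = ℝ^{n_1} × ⋯ × ℝ^{n_N}; for each i = 1,…,N let q_i : ℝ^{n_i} → (−∞, +∞] be proper, lower semicontinuous, and convex, let c_i > 0, and set Q(λ) = Σ_{i=1}^N q_i(λ_i) and Ψ = P + Q. Let D ∈ ℕ and τ : ℕ → ℕ satisfy 0 ≤ k − τ(k) ≤ D for all k. Let {λ(k)}_{k∈ℕ} be generated blockwise by λ_i(k+1) = prox^{c_i}_{q_i}[ λ_i(k) − c_i ∇_{λ_i} P(λ(τ(k))) ]. Then for every k ∈ ℕ, Ψ(λ(k+1)) − Ψ(λ(k)) ≤ (h/2)‖λ(k+1) − λ(τ(k))‖² − Σ_{i=1}^N (1/c_i)‖λ_i(k+1) − λ_i(k)‖². -/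

import Mathlib

open scoped RealInnerProductSpace
open Finset

noncomputable section

/-- A proper extended-real-valued function: never `⊥` and not identically `⊤`. -/
def ProperE {E : Type*} (f : E → EReal) : Prop :=
  (∀ x, f x ≠ ⊥) ∧ (∃ x, f x ≠ ⊤)

/-- Convexity for extended-real-valued functions. -/
def ERealConvexOn {E : Type*} [AddCommGroup E] [Module ℝ E] (f : E → EReal) : Prop :=
  ∀ x y : E, ∀ a b : ℝ, 0 ≤ a → 0 ≤ b → a + b = 1 →
    f (a • x + b • y) ≤ (a : EReal) * f x + (b : EReal) * f y

/-- The block decomposition `ℝ^n = ℝ^{n_1} × ⋯ × ℝ^{n_N}` with the Euclidean norm. -/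
abbrev Blk {N : ℕ} (dims : Fin N → ℕ) :=
  PiLp 2 (fun i : Fin N => EuclideanSpace ℝ (Fin (dims i)))

lemma EReal.coe_finset_sum {ι : Type*} (s : Finset ι) (f : ι → ℝ) :
    ((∑ i ∈ s, f i : ℝ) : EReal) = ∑ i ∈ s, (f i : EReal) := by
  classical
  induction s using Finset.induction_on with
  | empty => simp
  | insert a s ha ih => rw [sum_insert ha, sum_insert ha, EReal.coe_add, ih]

lemma EReal.finset_sum_ne_bot {ι : Type*} (s : Finset ι) (f : ι → EReal)
    (hf : ∀ i ∈ s, f i ≠ ⊥) : ∑ i ∈ s, f i ≠ ⊥ := by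
  classical
  induction s using Finset.induction_on with
  | empty => simp
  | insert a s ha ih =>
    rw [sum_insert ha, Ne, EReal.add_eq_bot_iff, not_or]
    exact ⟨hf a (mem_insert_self a s), ih fun i hi => hf i (mem_insert_of_mem hi)⟩

lemma EReal.finset_sum_eq_top {ι : Type*} {s : Finset ι} {f : ι → EReal}
    (hf : ∀ i ∈ s, f i ≠ ⊥) {j : ι} (hj : j ∈ s) (hfj : f j = ⊤) : ∑ i ∈ s, f i = ⊤ := by
  classical
  rw [← add_sum_erase s f hj, hfj]
  exact EReal.top_add_of_ne_bot
    (EReal.finset_sum_ne_bot _ _ fun i hi => hf i (mem_of_mem_erase hi))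

section InnerProduct

variable {E : Type*} [NormedAddCommGroup E] [InnerProductSpace ℝ E]

/-- A minimizer `p` of the proximal objective of `f` at `w` satisfies
`f p - f x ≤ -⟪p - w, p - x⟫ / c` at every `x` where `f` is finite. -/
lemma ERealConvexOn.prox_variational_inequality {f : E → EReal} (hf : ERealConvexOn f)
    {c : ℝ} {x w p : E} {a b : ℝ} (hp : f p = a) (hx : f x = b)
    (hmin : ∀ v, f p + ((1 / (2 * c) * ‖p - w‖ ^ 2 : ℝ) : EReal)
      ≤ f v + ((1 / (2 * c) * ‖v - w‖ ^ 2 : ℝ) : EReal)) :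
    a - b ≤ -(1 / c * ⟪p - w, p - x⟫) := by
  have key : ∀ t : ℝ, 0 < t → t ≤ 1 →
      a - b ≤ -(1 / c * ⟪p - w, p - x⟫) + t * (1 / (2 * c) * ‖p - x‖ ^ 2) := by
    intro t ht ht1
    have hconv := hf p x (1 - t) t (by linarith) ht.le (by ring)
    have hle := (hmin ((1 - t) • p + t • x)).trans (add_le_add_left hconv _)
    rw [hp, hx] at hle
    have hle' : a + 1 / (2 * c) * ‖p - w‖ ^ 2
        ≤ (1 - t) * a + t * b + 1 / (2 * c) * ‖(1 - t) • p + t • x - w‖ ^ 2 := by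
      exact_mod_cast hle
    have hv : (1 - t) • p + t • x - w = (p - w) - t • (p - x) := by module
    rw [hv, norm_sub_sq_real (p - w), inner_smul_right, norm_smul, mul_pow, Real.norm_eq_abs,
      sq_abs] at hle'
    refine le_of_mul_le_mul_left ?_ ht
    have h2 : 1 / c = 2 * (1 / (2 * c)) := by
      rw [one_div, one_div, mul_inv]; ring
    rw [h2]
    linarith
  have hlim : Filter.Tendsto
      (fun t : ℝ => -(1 / c * ⟪p - w, p - x⟫) + t * (1 / (2 * c) * ‖p - x‖ ^ 2))
      (nhdsWithin 0 (Set.Ioi 0)) (nhds (-(1 / c * ⟪p - w, p - x⟫))) := by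
    refine Filter.Tendsto.mono_left ?_ nhdsWithin_le_nhds
    refine Continuous.tendsto' (by fun_prop) _ _ (by simp)
  refine ge_of_tendsto hlim ?_
  filter_upwards [Ioc_mem_nhdsGT (zero_lt_one' ℝ)] with t ht
  exact key t ht.1 ht.2

variable [CompleteSpace E]

lemma HasGradientAt.hasDerivAt_comp_add_smul {f : E → ℝ} {g z u : E} {t : ℝ}
    (hf : HasGradientAt f g (z + t • u)) :
    HasDerivAt (fun s : ℝ => f (z + s • u)) ⟪g, u⟫ t := by
  have hline : HasDerivAt (fun s : ℝ => z + s • u) u t := by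
    simpa using ((hasDerivAt_id t).smul_const u).const_add z
  simpa [Function.comp_def] using hf.hasFDerivAt.comp_hasDerivAt t hline

/-- A convex function lies above its tangent planes. -/
lemma ConvexOn.add_inner_gradient_le {f : E → ℝ} (hf : ConvexOn ℝ Set.univ f) {g z : E}
    (hg : HasGradientAt f g z) (y : E) : f z + ⟪g, y - z⟫ ≤ f y := by
  have hd : HasDerivAt (fun s : ℝ => f (z + s • (y - z))) ⟪g, y - z⟫ 0 :=
    HasGradientAt.hasDerivAt_comp_add_smul (by simpa using hg)
  have hc : ConvexOn ℝ Set.univ (fun s : ℝ => f (z + s • (y - z))) := by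
    have := hf.comp_affineMap (AffineMap.lineMap z y : ℝ →ᵃ[ℝ] E)
    simpa [Function.comp_def, AffineMap.lineMap_apply, add_comm] using this
  have := hc.le_slope_of_hasDerivAt (Set.mem_univ 0) (Set.mem_univ 1) zero_lt_one hd
  simp [slope_def_field] at this
  linarith

/-- The descent lemma for functions with Lipschitz gradient. -/
lemma le_add_inner_gradient_add_sq {f : E → ℝ} {g : E → E} {h : ℝ}
    (hg : ∀ x, HasGradientAt f (g x) x) (hLip : ∀ u v, ‖g u - g v‖ ≤ h * ‖u - v‖) (z y : E) :
    f y ≤ f z + ⟪g z, y - z⟫ + h / 2 * ‖y - z‖ ^ 2 := by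
  set u := y - z with hu
  have hd : ∀ t : ℝ, HasDerivAt
      (fun s : ℝ => f (z + s • u) - (s * ⟪g z, u⟫ + s ^ 2 * (h / 2 * ‖u‖ ^ 2)))
      (⟪g (z + t • u), u⟫ - (⟪g z, u⟫ + 2 * t * (h / 2 * ‖u‖ ^ 2))) t := by
    intro t
    refine (hg _).hasDerivAt_comp_add_smul.sub (HasDerivAt.add ?_ ?_)
    · simpa using (hasDerivAt_id t).mul_const ⟪g z, u⟫
    · simpa using (hasDerivAt_pow 2 t).mul_const (h / 2 * ‖u‖ ^ 2)
  have hanti := antitoneOn_of_hasDerivWithinAt_nonpos (convex_Icc (0 : ℝ) 1)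
    (fun t _ => (hd t).continuousAt.continuousWithinAt)
    (fun t _ => (hd t).hasDerivWithinAt) (fun t ht => by
      rw [interior_Icc] at ht
      have h1 : ⟪g (z + t • u) - g z, u⟫ ≤ h * (t * ‖u‖) * ‖u‖ := by
        refine (real_inner_le_norm _ _).trans ?_
        gcongr
        simpa [norm_smul, abs_of_pos ht.1] using hLip (z + t • u) z
      rw [inner_sub_left] at h1
      linarith)
  have := hanti (Set.left_mem_Icc.2 zero_le_one) (Set.right_mem_Icc.2 zero_le_one) zero_le_one
  simp [hu] at this
  linarith

end InnerProduct

/-- per-step descent-type inequality for the asynchronous blockwise proximal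
gradient iteration, with `Ψ = P + Σᵢ qᵢ`:
`Ψ(λ(k+1)) − Ψ(λ(k)) ≤ (h/2)‖λ(k+1) − λ(τ(k))‖² − Σᵢ (1/cᵢ)‖λᵢ(k+1) − λᵢ(k)‖²`. -/
theorem stmt12 {N : ℕ} (dims : Fin N → ℕ) (h : ℝ) (hh : 0 < h)
    (P : Blk dims → ℝ) (gradP : Blk dims → Blk dims)
    (hPconv : ConvexOn ℝ Set.univ P)
    (hPdiff : ∀ x, HasGradientAt P (gradP x) x)
    (hLip : ∀ u v : Blk dims, ‖gradP u - gradP v‖ ≤ h * ‖u - v‖)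
    (q : ∀ i : Fin N, EuclideanSpace ℝ (Fin (dims i)) → EReal)
    (hqproper : ∀ i, ProperE (q i)) (hqlsc : ∀ i, LowerSemicontinuous (q i))
    (hqconv : ∀ i, ERealConvexOn (q i))
    (c : Fin N → ℝ) (hc : ∀ i, 0 < c i)
    (D : ℕ) (τ : ℕ → ℕ) (hτ : ∀ k : ℕ, τ k ≤ k ∧ k - τ k ≤ D)
    (lam : ℕ → Blk dims)
    (hiter : ∀ (k : ℕ) (i : Fin N), ∀ v : EuclideanSpace ℝ (Fin (dims i)),
      q i (lam (k + 1) i) +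
          ((1 / (2 * c i) *
            ‖lam (k + 1) i - (lam k i - c i • gradP (lam (τ k)) i)‖ ^ 2 : ℝ) : EReal)
        ≤ q i v +
          ((1 / (2 * c i) * ‖v - (lam k i - c i • gradP (lam (τ k)) i)‖ ^ 2 : ℝ) : EReal)) :
    ∀ k : ℕ,
      ((P (lam (k + 1)) : EReal) + ∑ i : Fin N, q i (lam (k + 1) i)) -
          ((P (lam k) : EReal) + ∑ i : Fin N, q i (lam k i))
        ≤ ((h / 2 * ‖lam (k + 1) - lam (τ k)‖ ^ 2
            - ∑ i : Fin N, (1 / c i) * ‖lam (k + 1) i - lam k i‖ ^ 2 : ℝ) : EReal) := by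
  intro k
  have hfin : ∀ i, q i (lam (k + 1) i) ≠ ⊤ := by
    intro i htop
    obtain ⟨v, hv⟩ := (hqproper i).2
    have hle := hiter k i v
    rw [htop, EReal.top_add_coe, top_le_iff] at hle
    exact EReal.add_ne_top hv (EReal.coe_ne_top _) hle
  by_cases htop : ∃ i, q i (lam k i) = ⊤
  · obtain ⟨j, hj⟩ := htop
    rw [EReal.finset_sum_eq_top (fun i _ => (hqproper i).1 _) (mem_univ j) hj,
      EReal.coe_add_top, EReal.sub_top]
    exact bot_le
  push Not at htop
  have ha : ∀ i, q i (lam (k + 1) i) = ((q i (lam (k + 1) i)).toReal : EReal) := fun i =>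
    (EReal.coe_toReal (hfin i) ((hqproper i).1 _)).symm
  have hb : ∀ i, q i (lam k i) = ((q i (lam k i)).toReal : EReal) := fun i =>
    (EReal.coe_toReal (htop i) ((hqproper i).1 _)).symm
  generalize hA : (fun i => (q i (lam (k + 1) i)).toReal) = A
  generalize hB : (fun i => (q i (lam k i)).toReal) = B
  replace ha : ∀ i, q i (lam (k + 1) i) = (A i : EReal) := fun i => by rw [← hA]; exact ha i
  replace hb : ∀ i, q i (lam k i) = (B i : EReal) := fun i => by rw [← hB]; exact hb i
  simp only [ha, hb, ← EReal.coe_finset_sum]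
  norm_cast
  have hblock : ∀ i, A i - B i ≤ -(1 / c i * ‖lam (k + 1) i - lam k i‖ ^ 2)
      - ⟪gradP (lam (τ k)) i, lam (k + 1) i - lam k i⟫ := by
    intro i
    have hprox := (hqconv i).prox_variational_inequality (ha i) (hb i) (hiter k i)
    have hw : lam (k + 1) i - (lam k i - c i • gradP (lam (τ k)) i)
        = (lam (k + 1) i - lam k i) + c i • gradP (lam (τ k)) i := by abel
    rw [hw, inner_add_left, real_inner_self_eq_norm_sq, real_inner_smul_left, mul_add,
      ← mul_assoc (1 / c i) (c i), one_div_mul_cancel (hc i).ne'] at hprox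
    linarith
  have hsum := sum_le_sum fun i (_ : i ∈ univ) => hblock i
  rw [sum_sub_distrib, sum_sub_distrib, sum_neg_distrib] at hsum
  have hinner : ⟪gradP (lam (τ k)), lam (k + 1) - lam k⟫
      = ∑ i, ⟪gradP (lam (τ k)) i, lam (k + 1) i - lam k i⟫ := by
    simp [PiLp.inner_apply]
  have hup := le_add_inner_gradient_add_sq hPdiff hLip (lam (τ k)) (lam (k + 1))
  have hlow := hPconv.add_inner_gradient_le (hPdiff (lam (τ k))) (lam k)
  have hsplit : ⟪gradP (lam (τ k)), lam (k + 1) - lam k⟫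
      = ⟪gradP (lam (τ k)), lam (k + 1) - lam (τ k)⟫
        - ⟪gradP (lam (τ k)), lam k - lam (τ k)⟫ := by
    rw [← inner_sub_right, sub_sub_sub_cancel_right]
  linarith
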